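/- Let G be a hyperbolic group with finite generating set A, let d ∈ V^A(p,γ,T) be a visual metric on G, and let φ be an endomorphism of G with Gφ ≠ {1}. If φ is a quasi-isometric embedding of (G,d_A) into itself, then there exist constants P > 0 and Q ∈ ℝ such that P·(gφ|hφ)^A_p + Q ≥ (g|h)^A_p for all g,h ∈ G, and consequently φ satisfies a Hölder condition as a map from (G,d) to (G,d). -/

import Mathlib

open scoped Classical

section Defs

variable {G : Type*}

/-- Word length of `g` with respect to a generating set `A`: the least `n` such that
`g` is a product of `n` elements of `A ∪ A⁻¹`. -/
noncomputable def wordLength [Group G] (A : Set G) (g : G) : ℕ :=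
  sInf {n : ℕ | ∃ w : List G, w.length = n ∧ (∀ x ∈ w, x ∈ A ∨ x⁻¹ ∈ A) ∧ w.prod = g}

/-- The word metric `d_A(g,h)` (as a real number). -/
noncomputable def wordDist [Group G] (A : Set G) (g h : G) : ℝ :=
  (wordLength A (g⁻¹ * h) : ℝ)

/-- The Gromov product `(x|y)_p` with respect to a distance function `d`. -/
noncomputable def gromov {X : Type*} (d : X → X → ℝ) (p x y : X) : ℝ :=
  (d p x + d p y - d x y) / 2

/-- `G` is `δ`-hyperbolic with respect to the generating set `A`. -/
def IsHyperbolicWith [Group G] (A : Set G) (δ : ℝ) : Prop :=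
  ∀ p g₀ g₁ g₂ : G,
    min (gromov (wordDist A) p g₀ g₁) (gromov (wordDist A) p g₁ g₂) - δ ≤
      gromov (wordDist A) p g₀ g₂

/-- `G` is hyperbolic with respect to the generating set `A`. -/
def IsHyperbolic [Group G] (A : Set G) : Prop :=
  ∃ δ : ℝ, 0 ≤ δ ∧ IsHyperbolicWith A δ

/-- `ρ_{p,γ}(g,h) = e^{-γ (g|h)_p}` (and `0` on the diagonal), with respect to a
distance function `dA`. -/
noncomputable def visualRhoOf {X : Type*} (dA : X → X → ℝ) (p : X) (γ : ℝ) (g h : X) : ℝ :=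
  if g = h then 0 else Real.exp (-γ * gromov dA p g h)

/-- `d` is a metric on `X`. -/
structure IsMetric {X : Type*} (d : X → X → ℝ) : Prop where
  refl : ∀ x, d x x = 0
  eq_of : ∀ x y, d x y = 0 → x = y
  symm : ∀ x y, d x y = d y x
  triangle : ∀ x y z, d x z ≤ d x y + d y z

/-- `d` is a visual metric in `V(p,γ,T)` with respect to the distance function `dA`. -/
def InVisualOf {X : Type*} (dA : X → X → ℝ) (p : X) (γ T : ℝ) (d : X → X → ℝ) : Prop :=
  IsMetric d ∧ ∀ g h : X, g ≠ h →
    visualRhoOf dA p γ g h / T ≤ d g h ∧ d g h ≤ T * visualRhoOf dA p γ g h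

/-- `d ∈ V^A(p,γ,T)`: `d` is a visual metric with respect to the word metric `d_A`. -/
def InVisual [Group G] (A : Set G) (p : G) (γ T : ℝ) (d : G → G → ℝ) : Prop :=
  InVisualOf (wordDist A) p γ T d

/-- `φ : (X,d) → (X,d')` satisfies a Hölder condition of exponent `r`. -/
def HolderCondWith {X : Type*} (d d' : X → X → ℝ) (φ : X → X) (r : ℝ) : Prop :=
  ∃ K : ℝ, 0 < K ∧ ∀ g h : X, d' (φ g) (φ h) ≤ K * d g h ^ r

/-- `φ : (X,d) → (X,d')` satisfies a Hölder condition (of some positive exponent). -/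
def SatisfiesHolder {X : Type*} (d d' : X → X → ℝ) (φ : X → X) : Prop :=
  ∃ r : ℝ, 0 < r ∧ HolderCondWith d d' φ r

/-- `φ : (X,d) → (X,d')` satisfies a Lipschitz condition. -/
def LipschitzCond {X : Type*} (d d' : X → X → ℝ) (φ : X → X) : Prop :=
  ∃ K : ℝ, 0 < K ∧ ∀ g h : X, d' (φ g) (φ h) ≤ K * d g h

/-- `φ : (X,d) → (X,d')` is uniformly continuous. -/
def UnifCont {X : Type*} (d d' : X → X → ℝ) (φ : X → X) : Prop :=
  ∀ ε : ℝ, 0 < ε → ∃ δ : ℝ, 0 < δ ∧ ∀ g h : X, d g h < δ → d' (φ g) (φ h) < ε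

/-- `φ : (X,d) → (X,d')` is a quasi-isometric embedding. -/
def QIEmbedding {X : Type*} (d d' : X → X → ℝ) (φ : X → X) : Prop :=
  ∃ lam K : ℝ, 1 ≤ lam ∧ 0 ≤ K ∧ ∀ g h : X,
    (1 / lam) * d g h - K ≤ d' (φ g) (φ h) ∧ d' (φ g) (φ h) ≤ lam * d g h + K

/-- `H` is a quasiconvex subset of `G` with respect to the generating set `A`:
every geodesic word-metric chain joining two points of `H` stays at bounded
distance from `H`. -/
def IsQuasiconvex [Group G] (A : Set G) (H : Set G) : Prop :=
  ∃ q : ℝ, 0 ≤ q ∧ ∀ h ∈ H, ∀ h' ∈ H, ∀ n : ℕ, ∀ g : ℕ → G,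
    g 0 = h → g n = h' → (n : ℝ) = wordDist A h h' →
    (∀ i < n, wordDist A (g i) (g (i + 1)) = 1) →
    ∀ i ≤ n, ∃ z ∈ H, wordDist A (g i) z ≤ q

end Defs

section WordMetric

variable {G : Type*} [Group G] {A : Set G}

theorem wordLength_le_of_list {w : List G} (hw : ∀ x ∈ w, x ∈ A ∨ x⁻¹ ∈ A) :
    wordLength A w.prod ≤ w.length :=
  Nat.sInf_le ⟨w, rfl, hw, rfl⟩

theorem exists_list_length_eq_wordLength (hA : Subgroup.closure A = ⊤) (g : G) :
    ∃ w : List G, w.length = wordLength A g ∧ (∀ x ∈ w, x ∈ A ∨ x⁻¹ ∈ A) ∧ w.prod = g := by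
  obtain ⟨w, hw, hprod⟩ := Submonoid.exists_list_of_mem_closure (s := A ∪ A⁻¹) (x := g)
    (by simp [← Subgroup.closure_toSubmonoid, hA])
  exact Nat.sInf_mem
    (s := {n : ℕ | ∃ w : List G, w.length = n ∧ (∀ x ∈ w, x ∈ A ∨ x⁻¹ ∈ A) ∧ w.prod = g})
    ⟨w.length, w, rfl, hw, hprod⟩

theorem wordLength_inv_le (hA : Subgroup.closure A = ⊤) (g : G) :
    wordLength A g⁻¹ ≤ wordLength A g := by
  obtain ⟨w, hlen, hw, rfl⟩ := exists_list_length_eq_wordLength hA g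
  rw [← hlen, List.prod_inv_reverse]
  refine (wordLength_le_of_list ?_).trans (by simp)
  intro x hx
  simp only [List.mem_reverse, List.mem_map] at hx
  obtain ⟨y, hy, rfl⟩ := hx
  simpa using (hw y hy).symm

theorem wordLength_mul_le (hA : Subgroup.closure A = ⊤) (g h : G) :
    wordLength A (g * h) ≤ wordLength A g + wordLength A h := by
  obtain ⟨v, hvl, hv, rfl⟩ := exists_list_length_eq_wordLength hA g
  obtain ⟨w, hwl, hw, rfl⟩ := exists_list_length_eq_wordLength hA h
  rw [← hvl, ← hwl, ← List.prod_append, ← List.length_append]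
  refine wordLength_le_of_list fun x hx => ?_
  rcases List.mem_append.1 hx with hx | hx
  exacts [hv x hx, hw x hx]

theorem isMetric_wordDist (hA : Subgroup.closure A = ⊤) : IsMetric (wordDist A) where
  refl x := by
    have := wordLength_le_of_list (A := A) (w := []) (by simp)
    simpa [wordDist] using this
  eq_of x y h := by
    obtain ⟨w, hlen, -, hprod⟩ := exists_list_length_eq_wordLength hA (x⁻¹ * y)
    have h0 : wordLength A (x⁻¹ * y) = 0 := Nat.cast_eq_zero.1 h
    rw [h0, List.length_eq_zero_iff] at hlen
    subst hlen
    exact inv_mul_eq_one.1 hprod.symm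
  symm x y := by
    have h1 := wordLength_inv_le hA (x⁻¹ * y)
    have h2 := wordLength_inv_le hA (y⁻¹ * x)
    simp only [mul_inv_rev, inv_inv] at h1 h2
    exact congrArg Nat.cast (le_antisymm h2 h1)
  triangle x y z := by
    have h := wordLength_mul_le hA (x⁻¹ * y) (y⁻¹ * z)
    rw [mul_assoc, mul_inv_cancel_left] at h
    unfold wordDist
    exact_mod_cast h

/-- Any two points of a group are joined by a discrete geodesic for the word metric. -/
theorem exists_wordDist_geodesic (hA : Subgroup.closure A = ⊤) (g h : G) :
    ∃ (n : ℕ) (y : ℕ → G), (n : ℝ) = wordDist A g h ∧ y 0 = g ∧ y n = h ∧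
      ∀ i j, i ≤ j → wordDist A (y i) (y j) ≤ (j : ℝ) - i := by
  obtain ⟨w, hlen, hw, hprod⟩ := exists_list_length_eq_wordLength hA (g⁻¹ * h)
  refine ⟨w.length, fun i => g * (w.take i).prod, by rw [hlen]; rfl, by simp,
    by simp [hprod], fun i j hij => ?_⟩
  obtain ⟨k, rfl⟩ := Nat.exists_eq_add_of_le hij
  have h1 : (g * (w.take i).prod)⁻¹ * (g * (w.take (i + k)).prod)
      = ((w.drop i).take k).prod := by
    rw [List.take_add, List.prod_append]
    group
  have h2 : wordLength A ((w.drop i).take k).prod ≤ k :=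
    (wordLength_le_of_list fun x hx =>
      hw x (List.mem_of_mem_drop (List.mem_of_mem_take hx))).trans (by simp)
  rw [wordDist, h1]
  push_cast
  have : (wordLength A ((w.drop i).take k).prod : ℝ) ≤ k := by exact_mod_cast h2
  linarith

end WordMetric

section GromovProduct

variable {X : Type*} {d : X → X → ℝ}

theorem IsMetric.nonneg (hd : IsMetric d) (x y : X) : 0 ≤ d x y := by
  have := hd.triangle x y x
  rw [hd.refl, hd.symm y x] at this
  linarith

theorem gromov_comm (hd : IsMetric d) (p x y : X) : gromov d p x y = gromov d p y x := by
  simp only [gromov, hd.symm x y, add_comm]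

theorem gromov_le_gromov_add (hd : IsMetric d) (p q x y : X) :
    gromov d q x y ≤ gromov d p x y + d p q := by
  have h1 := hd.triangle q p x
  have h2 := hd.triangle q p y
  rw [hd.symm q p] at h1 h2
  simp only [gromov]
  linarith

/-- In a hyperbolic space, a chain of bounded steps that moves away from `q` with speed at
least the hyperbolicity constant has endpoints whose Gromov product is controlled by the
distance from `q` to the start of the chain. -/
theorem le_gromov_of_chain (hd : IsMetric d) {δ : ℝ} {q : X}
    (hyp : ∀ x y z, min (gromov d q x y) (gromov d q y z) - δ ≤ gromov d q x z)
    {L : ℝ} (hL : 0 ≤ L) (n : ℕ) :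
    ∀ (f : ℕ → X) (B : ℝ), (∀ j ≤ n, B + δ * j ≤ d q (f j)) →
      (∀ j < n, d (f j) (f (j + 1)) ≤ L) → B - L ≤ gromov d q (f 0) (f n) := by
  induction n with
  | zero =>
    intro f B hB _
    have := hB 0 le_rfl
    simp only [gromov, hd.refl]
    simp at this
    linarith
  | succ n ih =>
    intro f B hB hs
    have h1 := ih (fun j => f (j + 1)) (B + δ)
      (fun j hj => by have := hB (j + 1) (by omega); push_cast at this; linarith)
      (fun j hj => hs (j + 1) (by omega))
    have h2 : B + δ - L ≤ gromov d q (f 0) (f 1) := by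
      have h3 := hB 1 (by omega)
      have h4 := hs 0 (by omega)
      have h5 := hd.triangle q (f 0) (f 1)
      simp only [gromov]
      simp only [Nat.cast_one, mul_one, zero_add] at h3 h4
      linarith
    have h3 := hyp (f 0) (f 1) (f (n + 1))
    have h4 := le_min h2 h1
    simp only [zero_add] at h4
    linarith

/-- The image under a quasi-isometric embedding of a discrete path that moves away from `p`
linearly has endpoints with large Gromov product. -/
theorem le_gromov_map_of_path (hd : IsMetric d) {δ : ℝ} {φ : X → X} {p : X}
    (hyp : ∀ x y z, min (gromov d (φ p) x y) (gromov d (φ p) y z) - δ ≤ gromov d (φ p) x z)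
    {lam K : ℝ} (hlam : 1 ≤ lam) (hK : 0 ≤ K)
    (hφ : ∀ x y, (1 / lam) * d x y - K ≤ d (φ x) (φ y) ∧ d (φ x) (φ y) ≤ lam * d x y + K)
    {L : ℕ} (hL : 0 < L) (hLδ : 4 * lam * δ ≤ L) {m : ℝ} {k : ℕ} {y : ℕ → X}
    (hy : ∀ i j, i ≤ j → j ≤ k → d (y i) (y j) ≤ (j : ℝ) - i)
    (hm : ∀ i ≤ k, m / 2 + ((i : ℝ) - 1) / 4 ≤ d p (y i)) :
    (1 / lam) * (m / 2 - (L + 1) / 4) - K - (lam * L + K) ≤ gromov d (φ p) (φ (y 0)) (φ (y k)) := by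
  have hlam0 : 0 < lam := by linarith
  have key := le_gromov_of_chain hd hyp (L := lam * L + K) (by positivity) (k / L + 1)
    (fun j => φ (y (min (L * j) k))) ((1 / lam) * (m / 2 - (L + 1) / 4) - K) ?_ ?_
  · have hk : k ≤ L * (k / L + 1) := (Nat.lt_mul_div_succ k hL).le
    simpa [hk] using key
  · intro j hj
    have h1 := hm (min (L * j) k) (min_le_right _ _)
    have h2 : L * j ≤ min (L * j) k + L := by
      have h3 : L * j ≤ L * (k / L + 1) := Nat.mul_le_mul_left L hj
      have h4 : L * (k / L) ≤ k := Nat.mul_div_le k L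
      rw [mul_add, mul_one] at h3
      omega
    have h2' : (L : ℝ) * j ≤ (min (L * j) k : ℕ) + L := by exact_mod_cast h2
    have h5 : m / 2 - (L + 1) / 4 + lam * δ * j ≤ d p (y (min (L * j) k)) := by
      have : 4 * lam * δ * j ≤ L * j := by gcongr
      linarith
    have h6 := mul_le_mul_of_nonneg_left h5 (one_div_nonneg.2 hlam0.le)
    have h7 := (hφ p (y (min (L * j) k))).1
    have h8 : (1 / lam) * (m / 2 - (L + 1) / 4 + lam * δ * j)
        = (1 / lam) * (m / 2 - (L + 1) / 4) + δ * j := by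
      field_simp
    linarith
  · intro j _
    have h1 : min (L * j) k ≤ min (L * (j + 1)) k :=
      min_le_min_right k (Nat.mul_le_mul_left L (Nat.le_succ j))
    have h2 : min (L * (j + 1)) k ≤ min (L * j) k + L := by
      rw [mul_add, mul_one]
      omega
    have h2' : ((min (L * (j + 1)) k : ℕ) : ℝ) ≤ (min (L * j) k : ℕ) + L := by exact_mod_cast h2
    have h3 := hy _ _ h1 (min_le_right _ _)
    have h4 : d (y (min (L * j) k)) (y (min (L * (j + 1)) k)) ≤ L := by linarith
    have h5 := mul_le_mul_of_nonneg_left h4 hlam0.le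
    have h6 := (hφ (y (min (L * j) k)) (y (min (L * (j + 1)) k))).2
    linarith

/-- A quasi-isometric embedding of a hyperbolic discretely geodesic space into itself distorts
Gromov products at most linearly from below. -/
theorem QIEmbedding.exists_gromov_le (hd : IsMetric d)
    (hgeo : ∀ g h, ∃ (n : ℕ) (y : ℕ → X), (n : ℝ) = d g h ∧ y 0 = g ∧ y n = h ∧
      ∀ i j, i ≤ j → d (y i) (y j) ≤ (j : ℝ) - i)
    {δ : ℝ}
    (hyp : ∀ p x y z, min (gromov d p x y) (gromov d p y z) - δ ≤ gromov d p x z)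
    {φ : X → X} (hφ : QIEmbedding d d φ) (p : X) :
    ∃ P Q : ℝ, 0 < P ∧ ∀ g h, gromov d p g h ≤ P * gromov d p (φ g) (φ h) + Q := by
  obtain ⟨lam, K, hlam, hK, hqi⟩ := hφ
  have hlam0 : 0 < lam := by linarith
  obtain ⟨L₀, hL₀⟩ := exists_nat_ge (4 * lam * δ)
  obtain ⟨L, hL, hLδ⟩ : ∃ L : ℕ, 0 < L ∧ 4 * lam * δ ≤ L :=
    ⟨L₀ + 1, by omega, by push_cast; linarith⟩
  refine ⟨2 * lam, ((L : ℝ) + 1) / 2 + 2 * lam * (K + (lam * L + K) + δ + d p (φ p)),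
    by positivity, fun g h => ?_⟩
  obtain ⟨n, y, hn, rfl, rfl, hy⟩ := hgeo g h
  set m := gromov d p (y 0) (y n) with hmdef
  set a := d p (y 0) with ha
  set b := d p (y n) with hb
  have hm : 2 * m = a + b - n := by rw [hmdef, gromov, ← hn]; ring
  have t1 : b ≤ a + n := by rw [hn]; exact hd.triangle p (y 0) (y n)
  have t2 : a ≤ b + n := by
    rw [hn, hd.symm (y 0)]; exact hd.triangle p (y n) (y 0)
  have hlow : ∀ i ≤ n, m ≤ d p (y i) := by
    intro i hi
    have h1 := hy 0 i (by omega)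
    have h2 := hy i n hi
    have h3 := hd.triangle p (y i) (y 0)
    have h4 := hd.triangle p (y i) (y n)
    rw [hd.symm (y i) (y 0)] at h3
    push_cast at h1
    linarith
  have hright : ∀ i ≤ n, (i : ℝ) - a ≤ d p (y i) := by
    intro i hi
    have h2 := hy i n hi
    have h3 := hd.triangle (y 0) p (y i)
    have h4 := hd.triangle (y 0) (y i) (y n)
    rw [hd.symm (y 0) p] at h3
    linarith
  have hleft : ∀ i ≤ n, (n : ℝ) - i - b ≤ d p (y i) := by
    intro i hi
    have h2 := hy 0 i (by omega)
    have h3 := hd.triangle (y i) p (y n)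
    have h4 := hd.triangle (y 0) (y i) (y n)
    rw [hd.symm (y i) p] at h3
    push_cast at h2
    linarith
  obtain ⟨c, hcn, hc1, hc2⟩ : ∃ c : ℕ, c ≤ n ∧ (c : ℝ) ≤ a - m ∧ a - m < c + 1 := by
    have h0 : 0 ≤ a - m := by linarith
    refine ⟨⌊a - m⌋₊, ?_, Nat.floor_le h0, Nat.lt_floor_add_one _⟩
    exact Nat.floor_le_of_le (by linarith)
  have key1 := le_gromov_map_of_path hd (hyp (φ p)) hlam hK hqi hL hLδ
    (m := m) (k := n - c) (y := fun i => y (c + i))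
    (fun i j hij _ => by
      have := hy (c + i) (c + j) (by omega)
      push_cast at this
      linarith)
    (fun i hi => by
      have h1 := hlow (c + i) (by omega)
      have h2 := hright (c + i) (by omega)
      push_cast at h2
      linarith)
  have key2 := le_gromov_map_of_path hd (hyp (φ p)) hlam hK hqi hL hLδ
    (m := m) (k := c) (y := fun i => y (c - i))
    (fun i j hij hj => by
      have := hy (c - j) (c - i) (by omega)
      rw [Nat.cast_sub hj, Nat.cast_sub (hij.trans hj)] at this
      rw [hd.symm]
      linarith)
    (fun i hi => by
      have h1 := hlow (c - i) (by omega)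
      have h2 := hleft (c - i) (by omega)
      rw [Nat.cast_sub hi] at h2
      linarith)
  simp only [add_zero, Nat.add_sub_cancel' hcn] at key1
  simp only [Nat.sub_zero, Nat.sub_self] at key2
  rw [gromov_comm hd] at key2
  have key3 := hyp (φ p) (φ (y 0)) (φ (y c)) (φ (y n))
  have key4 := le_min key2 key1
  have key5 := gromov_le_gromov_add hd p (φ p) (φ (y 0)) (φ (y n))
  have key6 : (1 / lam) * (m / 2 - (L + 1) / 4) - K - (lam * L + K) - δ - d p (φ p)
      ≤ gromov d p (φ (y 0)) (φ (y n)) := by linarith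
  have key7 := mul_le_mul_of_nonneg_left key6 (by positivity : 0 ≤ 2 * lam)
  have key8 : 2 * lam * ((1 / lam) * (m / 2 - (L + 1) / 4) - K - (lam * L + K) - δ - d p (φ p))
      = m - (L + 1) / 2 - 2 * lam * (K + (lam * L + K) + δ + d p (φ p)) := by
    field_simp
    ring
  linarith

/-- A self-map that distorts Gromov products at most linearly from below is Hölder with respect
to visual metrics. -/
theorem InVisualOf.satisfiesHolder {p : X} {γ T : ℝ} (hγ : 0 < γ) (hT : 1 ≤ T) {ρ : X → X → ℝ}
    (hρ : InVisualOf d p γ T ρ) {φ : X → X} {P Q : ℝ} (hP : 0 < P)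
    (h : ∀ x y, gromov d p x y ≤ P * gromov d p (φ x) (φ y) + Q) : SatisfiesHolder ρ ρ φ := by
  obtain ⟨hmet, hvis⟩ := hρ
  have hT0 : 0 < T := by linarith
  refine ⟨1 / P, by positivity, T * Real.exp (γ * Q / P) * T ^ (1 / P), by positivity,
    fun x y => ?_⟩
  by_cases hxy : φ x = φ y
  · have := hmet.nonneg x y
    rw [hxy, hmet.refl]
    positivity
  have hne : x ≠ y := fun e => hxy (congrArg φ e)
  have h1 := (hvis _ _ hxy).2
  have h2 := (hvis _ _ hne).1
  rw [visualRhoOf, if_neg hxy] at h1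
  rw [visualRhoOf, if_neg hne, div_le_iff₀' hT0] at h2
  have h3 := Real.rpow_le_rpow (Real.exp_pos _).le h2 (one_div_nonneg.2 hP.le)
  rw [Real.mul_rpow hT0.le (hmet.nonneg x y), ← Real.exp_mul] at h3
  have h4 : Real.exp (-γ * gromov d p (φ x) (φ y))
      ≤ Real.exp (γ * Q / P) * Real.exp (-γ * gromov d p x y * (1 / P)) := by
    rw [← Real.exp_add, Real.exp_le_exp]
    have h5 := mul_le_mul_of_nonneg_left (h x y) hγ.le
    have h6 : γ * Q / P + -γ * gromov d p x y * (1 / P)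
        = (γ * Q - γ * gromov d p x y) / P := by ring
    rw [h6, le_div_iff₀ hP]
    linarith
  calc ρ (φ x) (φ y) ≤ T * Real.exp (-γ * gromov d p (φ x) (φ y)) := h1
    _ ≤ T * (Real.exp (γ * Q / P) * (T ^ (1 / P) * ρ x y ^ (1 / P))) := by
        refine mul_le_mul_of_nonneg_left (h4.trans ?_) hT0.le
        exact mul_le_mul_of_nonneg_left h3 (Real.exp_pos _).le
    _ = T * Real.exp (γ * Q / P) * T ^ (1 / P) * ρ x y ^ (1 / P) := by ring

end GromovProduct

/-- If a nontrivial endomorphism of a hyperbolic group is a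
quasi-isometric embedding of `(G,d_A)` into itself, then Gromov products satisfy
`P (gφ|hφ)^A_p + Q ≥ (g|h)^A_p` for some `P > 0`, `Q`, and consequently `φ` satisfies a
Hölder condition with respect to the visual metric `d`. -/
theorem stmt_9 {G : Type*} [Group G] (A : Set G)
    (hAfin : A.Finite) (hAgen : Subgroup.closure A = ⊤) (hhyp : IsHyperbolic A)
    (p : G) (γ T : ℝ) (hγ : 0 < γ) (hT : 1 ≤ T)
    (d : G → G → ℝ) (hd : InVisual A p γ T d)
    (φ : G →* G) (hnt : ∃ g : G, φ g ≠ 1)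
    (hqi : QIEmbedding (wordDist A) (wordDist A) ⇑φ) :
    (∃ P Q : ℝ, 0 < P ∧ ∀ g h : G,
        gromov (wordDist A) p g h ≤ P * gromov (wordDist A) p (φ g) (φ h) + Q) ∧
      SatisfiesHolder d d ⇑φ := by
  obtain ⟨δ, -, hyp⟩ := hhyp
  obtain ⟨P, Q, hP, hPQ⟩ := hqi.exists_gromov_le (isMetric_wordDist hAgen)
    (exists_wordDist_geodesic hAgen) hyp p
  exact ⟨⟨P, Q, hP, hPQ⟩, InVisualOf.satisfiesHolder hγ hT hd hP hPQ⟩
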